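/- Let M be a positive integer and q ∈ (1, M+1]. If q ∈ U, i.e., 1 has a unique q-expansion, then for every r ∈ (q, M+1] and every ρ with r ≤ ρ ≤ M+1, the Hausdorff dimension of π_ρ(U'_r \ U'_q) is strictly positive. -/

import Mathlib

open Set MeasureTheory Filter

noncomputable section

/-- The projection `π_q` of a digit sequence (0-indexed): `∑ d i / q^(i+1)`. -/
def piQ (q : ℝ) (d : ℕ → ℕ) : ℝ := ∑' i : ℕ, (d i : ℝ) / q ^ (i + 1)

/-- `d` is a `q`-expansion of `x` over the alphabet `{0,…,M}`. -/
def IsExpansion (M : ℕ) (q x : ℝ) (d : ℕ → ℕ) : Prop :=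
  (∀ i, d i ≤ M) ∧ piQ q d = x

/-- `U'_q`: digit sequences that are the unique `q`-expansion of their projection. -/
def UnivSeqs (M : ℕ) (q : ℝ) : Set (ℕ → ℕ) :=
  {d | (∀ i, d i ≤ M) ∧ ∀ e : ℕ → ℕ, IsExpansion M q (piQ q d) e → e = d}

/-- The set `U = U(M)` of univoque bases: `q ∈ (1, M+1]` such that `1` has a
unique `q`-expansion over `{0,…,M}`. -/
def UnivBases (M : ℕ) : Set ℝ :=
  {q | 1 < q ∧ q ≤ M + 1 ∧ ∃! d : ℕ → ℕ, IsExpansion M q 1 d}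

/-- The Komornik–Loreti constant `q'(M) = min U(M)`. -/
def KL (M : ℕ) : ℝ := sInf (UnivBases M)

/-- `(a, b)` is a connected component of `(q'(M), M+1) \ closure (U(M))`:
an open subinterval whose endpoints do not lie in that (open) set. -/
def CC (M : ℕ) (a b : ℝ) : Prop :=
  a < b ∧ Ioo a b ⊆ Ioo (KL M) (M + 1) \ closure (UnivBases M) ∧
    a ∉ Ioo (KL M) (M + 1) \ closure (UnivBases M) ∧
    b ∉ Ioo (KL M) (M + 1) \ closure (UnivBases M)

/-- `x ∈ [0, M/(q-1)]` has exactly two distinct `q`-expansions. -/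
def HasExactlyTwoExpansions (M : ℕ) (q x : ℝ) : Prop :=
  ∃ c d : ℕ → ℕ, c ≠ d ∧ IsExpansion M q x c ∧ IsExpansion M q x d ∧
    ∀ e : ℕ → ℕ, IsExpansion M q x e → e = c ∨ e = d

/-- `B_2(M)`: bases `q ∈ (1, M+1]` for which some `x ∈ [0, M/(q-1)]` has exactly
two `q`-expansions. -/
def B2 (M : ℕ) : Set ℝ :=
  {q | 1 < q ∧ q ≤ M + 1 ∧
    ∃ x ∈ Icc (0 : ℝ) (M / (q - 1)), HasExactlyTwoExpansions M q x}

/-- Strict lexicographic order on digit sequences. -/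
def seqLt (a b : ℕ → ℕ) : Prop := ∃ n, (∀ i < n, a i = b i) ∧ a n < b n

/-- Lexicographic order on digit sequences. -/
def seqLe (a b : ℕ → ℕ) : Prop := seqLt a b ∨ a = b

/-- A digit sequence is infinite if it does not end with `0^∞` after a last
nonzero digit (in particular `0^∞` is infinite). -/
def IsInfiniteSeq (a : ℕ → ℕ) : Prop := ¬∃ m, a m ≠ 0 ∧ ∀ i > m, a i = 0

/-- `a = α(q)`, the quasi-greedy `q`-expansion of `1`: the lexicographically
largest infinite `q`-expansion of `1`. -/
def IsQuasiGreedy (M : ℕ) (q : ℝ) (a : ℕ → ℕ) : Prop :=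
  IsExpansion M q 1 a ∧ IsInfiniteSeq a ∧
    ∀ b : ℕ → ℕ, IsExpansion M q 1 b → IsInfiniteSeq b → seqLe b a

/-- `b = β(q)`, the greedy `q`-expansion of `1`: the lexicographically largest
`q`-expansion of `1`. -/
def IsGreedy (M : ℕ) (q : ℝ) (b : ℕ → ℕ) : Prop :=
  IsExpansion M q 1 b ∧ ∀ c : ℕ → ℕ, IsExpansion M q 1 c → seqLe c b

/-- `w⁺`: increase the last digit of a word by one. -/
def plusWord : List ℕ → List ℕ
  | [] => []
  | [a] => [a + 1]
  | a :: b :: rest => a :: plusWord (b :: rest)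

/-- `w⁻`: decrease the last digit of a word by one. -/
def minusWord : List ℕ → List ℕ
  | [] => []
  | [a] => [a - 1]
  | a :: b :: rest => a :: minusWord (b :: rest)

/-- The reflection of a word: `\overline{w} = (M - w_1) ⋯ (M - w_k)`. -/
def reflWord (M : ℕ) (w : List ℕ) : List ℕ := w.map fun a => M - a

/-- The substitution `g(w) = w⁺ \overline{w⁺}`. -/
def gWord (M : ℕ) (w : List ℕ) : List ℕ := plusWord w ++ reflWord M (plusWord w)

/-- The periodic sequence `t^∞` determined by a word `t`. -/
def periodicSeq (t : List ℕ) (i : ℕ) : ℕ := t.getD (i % t.length) 0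

/-- Strict lexicographic order on words. -/
def wordLt (u v : List ℕ) : Prop := List.Lex (· < ·) u v

/-- Lexicographic order on words. -/
def wordLe (u v : List ℕ) : Prop := wordLt u v ∨ u = v

/-- The connected component `(q_0, q_0^*)` of `(q'(M), M+1) \ closure (U(M))` is
generated by the word `t`, and `θ = α(q_0^*)`: `α(q_0) = t^∞` and
`α(q_0^*) = lim_{n→∞} g^n(t)`, i.e. every `g^n(t)` is a prefix of `θ`. -/
def GeneratedBy (M : ℕ) (q₀ q₀star : ℝ) (t : List ℕ) (θ : ℕ → ℕ) : Prop :=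
  CC M q₀ q₀star ∧ t ≠ [] ∧ IsQuasiGreedy M q₀ (periodicSeq t) ∧
    IsQuasiGreedy M q₀star θ ∧
    ∀ n : ℕ, ∀ i < ((gWord M)^[n] t).length, ((gWord M)^[n] t).getD i 0 = θ i


/-- The sequence with its first `n` digits removed. -/
def shiftSeq (n : ℕ) (d : ℕ → ℕ) : ℕ → ℕ := fun i => d (n + i)

/-- The digitwise reflection of a sequence. -/
def reflSeq (M : ℕ) (d : ℕ → ℕ) : ℕ → ℕ := fun i => M - d i

/-- Lexicographic comparison of the prefixes of length `N`. -/
def PrefixLe (N : ℕ) (s t : ℕ → ℕ) : Prop := ∀ j < N, (∀ i < j, s i = t i) → s j ≤ t j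

lemma reflSeq_le (M : ℕ) (d : ℕ → ℕ) (i : ℕ) : reflSeq M d i ≤ M := Nat.sub_le _ _

lemma reflSeq_reflSeq {M : ℕ} {d : ℕ → ℕ} (hd : ∀ i, d i ≤ M) :
    reflSeq M (reflSeq M d) = d := by
  funext i
  have := hd i
  simp only [reflSeq]
  omega

lemma shiftSeq_zero (d : ℕ → ℕ) : shiftSeq 0 d = d := by
  funext i
  simp [shiftSeq]

lemma shiftSeq_shiftSeq (k n : ℕ) (d : ℕ → ℕ) :
    shiftSeq k (shiftSeq n d) = shiftSeq (n + k) d := by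
  funext i
  simp [shiftSeq, add_assoc]

lemma shiftSeq_reflSeq (M n : ℕ) (d : ℕ → ℕ) :
    shiftSeq n (reflSeq M d) = reflSeq M (shiftSeq n d) := rfl

lemma hasSum_const_div_pow {q : ℝ} (hq : 1 < q) (C : ℝ) :
    HasSum (fun i : ℕ => C / q ^ (i + 1)) (C / (q - 1)) := by
  have h := (hasSum_geometric_of_lt_one (r := q⁻¹) (by positivity)
    (inv_lt_one_of_one_lt₀ hq)).mul_left (C / q)
  have hq0 : q ≠ 0 := by positivity
  have h1 : C / (q - 1) = C / q * (1 - q⁻¹)⁻¹ := by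
    have hq1 : q - 1 ≠ 0 := by linarith
    rw [show 1 - q⁻¹ = (q - 1) / q by field_simp]
    field_simp
  have h2 : (fun i : ℕ => C / q ^ (i + 1)) = fun i => C / q * q⁻¹ ^ i := by
    funext i
    rw [inv_pow, pow_succ]
    field_simp
  rw [h1, h2]
  exact h

lemma summable_piQ {M : ℕ} {q : ℝ} (hq : 1 < q) {d : ℕ → ℕ} (hd : ∀ i, d i ≤ M) :
    Summable (fun i : ℕ => (d i : ℝ) / q ^ (i + 1)) := by
  refine Summable.of_nonneg_of_le (fun i => by positivity) (fun i => ?_)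
    (hasSum_const_div_pow hq (M : ℝ)).summable
  have : (d i : ℝ) ≤ M := by exact_mod_cast hd i
  gcongr

lemma piQ_nonneg {q : ℝ} (hq : 1 < q) (d : ℕ → ℕ) : 0 ≤ piQ q d :=
  tsum_nonneg fun i => by positivity

lemma piQ_le {M : ℕ} {q : ℝ} (hq : 1 < q) {d : ℕ → ℕ} (hd : ∀ i, d i ≤ M) :
    piQ q d ≤ M / (q - 1) := by
  rw [← (hasSum_const_div_pow hq (M : ℝ)).tsum_eq]
  refine (summable_piQ hq hd).tsum_le_tsum (fun i => ?_)
    (hasSum_const_div_pow hq (M : ℝ)).summable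
  have : (d i : ℝ) ≤ M := by exact_mod_cast hd i
  gcongr

lemma piQ_reflSeq {M : ℕ} {q : ℝ} (hq : 1 < q) {d : ℕ → ℕ} (hd : ∀ i, d i ≤ M) :
    piQ q (reflSeq M d) = M / (q - 1) - piQ q d := by
  rw [← (hasSum_const_div_pow hq (M : ℝ)).tsum_eq, piQ, piQ,
    ← (hasSum_const_div_pow hq (M : ℝ)).summable.tsum_sub (summable_piQ hq hd)]
  congr 1
  funext i
  rw [reflSeq, Nat.cast_sub (hd i), sub_div]

lemma piQ_anti {M : ℕ} {q r : ℝ} (hq : 1 < q) (hqr : q ≤ r) {d : ℕ → ℕ} (hd : ∀ i, d i ≤ M) :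
    piQ r d ≤ piQ q d := by
  refine (summable_piQ (hq.trans_le hqr) hd).tsum_le_tsum (fun i => ?_) (summable_piQ hq hd)
  gcongr

lemma piQ_eq_sum_add {M : ℕ} {q : ℝ} (hq : 1 < q) {d : ℕ → ℕ} (hd : ∀ i, d i ≤ M) (n : ℕ) :
    piQ q d = ∑ i ∈ Finset.range n, (d i : ℝ) / q ^ (i + 1) + piQ q (shiftSeq n d) / q ^ n := by
  have hq0 : q ≠ 0 := by positivity
  rw [piQ, ← (summable_piQ hq hd).sum_add_tsum_nat_add n, piQ, ← tsum_div_const]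
  congr 2
  funext i
  rw [shiftSeq, div_div, ← pow_add, Nat.add_comm i n]
  congr 2
  ring

lemma mul_piQ_shiftSeq {M : ℕ} {q : ℝ} (hq : 1 < q) {d : ℕ → ℕ} (hd : ∀ i, d i ≤ M) (n : ℕ) :
    q * piQ q (shiftSeq n d) = d n + piQ q (shiftSeq (n + 1) d) := by
  have hq0 : q ≠ 0 := by positivity
  rw [piQ_eq_sum_add hq (d := shiftSeq n d) (fun i => hd _) 1]
  rw [shiftSeq_shiftSeq]
  simp [shiftSeq]
  field_simp

/-- Two sequences that agree before position `n` are compared through their tails. -/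
lemma piQ_sub_piQ {M : ℕ} {q : ℝ} (hq : 1 < q) {d e : ℕ → ℕ} (hd : ∀ i, d i ≤ M)
    (he : ∀ i, e i ≤ M) {n : ℕ} (h : ∀ i < n, d i = e i) :
    piQ q d - piQ q e =
      ((d n + piQ q (shiftSeq (n + 1) d)) - (e n + piQ q (shiftSeq (n + 1) e))) / q ^ (n + 1) := by
  have hq0 : q ≠ 0 := by positivity
  rw [piQ_eq_sum_add hq hd n, piQ_eq_sum_add hq he n, ← mul_piQ_shiftSeq hq hd,
    ← mul_piQ_shiftSeq hq he, Finset.sum_congr rfl fun i hi => by rw [h i (Finset.mem_range.1 hi)]]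
  rw [pow_succ]
  field_simp
  ring

lemma div_le_piQ_sub_piQ {M : ℕ} {q T : ℝ} (hq : 1 < q) {d e : ℕ → ℕ} (hd : ∀ i, d i ≤ M)
    (he : ∀ i, e i ≤ M) {n : ℕ} (h : ∀ i < n, d i = e i) (hn : e n < d n)
    (hT : piQ q (shiftSeq (n + 1) e) ≤ T) :
    (1 - T) / q ^ (n + 1) ≤ piQ q d - piQ q e := by
  rw [piQ_sub_piQ hq hd he h]
  have h1 : (e n : ℝ) + 1 ≤ d n := by exact_mod_cast hn
  have h2 := piQ_nonneg hq (shiftSeq (n + 1) d)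
  gcongr ?_ / _
  linarith

lemma exists_expansion {M : ℕ} {q : ℝ} (hq : 1 < q) (hqM : q ≤ M + 1) {x : ℝ}
    (hx : x ∈ Icc 0 (M / (q - 1))) : ∃ d, IsExpansion M q x d := by
  have hq1 : 0 < q - 1 := by linarith
  have hM1 : 1 ≤ (M : ℝ) / (q - 1) := by
    rw [le_div_iff₀ hq1]
    linarith
  have hMq : q * (M / (q - 1)) = M + M / (q - 1) := by
    field_simp
    ring
  have step : ∀ y : Icc (0 : ℝ) (M / (q - 1)), ∃ z : ℕ × Icc (0 : ℝ) (M / (q - 1)),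
      z.1 ≤ M ∧ q * y = z.1 + z.2 := by
    rintro ⟨y, hy0, hy1⟩
    have hqy : 0 ≤ q * y := by positivity
    by_cases h : ⌊q * y⌋₊ ≤ M
    · refine ⟨(⌊q * y⌋₊, ⟨q * y - ⌊q * y⌋₊, ?_, ?_⟩), h, by simp⟩
      · linarith [Nat.floor_le hqy]
      · linarith [Nat.lt_floor_add_one (q * y)]
    · have h' : (M : ℝ) ≤ q * y := (Nat.le_floor_iff hqy).1 (by omega)
      refine ⟨(M, ⟨q * y - M, by linarith, ?_⟩), le_rfl, by simp⟩
      have : q * y ≤ q * (M / (q - 1)) := by gcongr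
      linarith
  choose g hg1 hg2 using step
  let y : ℕ → Icc (0 : ℝ) (M / (q - 1)) := fun n => (fun z => (g z).2)^[n] ⟨x, hx⟩
  have hy : ∀ n, q * (y n : ℝ) = (g (y n)).1 + y (n + 1) := by
    intro n
    rw [hg2, show y (n + 1) = (g (y n)).2 from Function.iterate_succ_apply' _ _ _]
  have hd : ∀ n, (g (y n)).1 ≤ M := fun n => hg1 _
  refine ⟨fun n => (g (y n)).1, hd, ?_⟩
  have hsum : ∀ n, ∑ i ∈ Finset.range n, (((g (y i)).1 : ℕ) : ℝ) / q ^ (i + 1)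
      = x - y n / q ^ n := by
    intro n
    induction n with
    | zero => simp [y]
    | succ n ih =>
      rw [Finset.sum_range_succ, ih, pow_succ]
      have := hy n
      field_simp
      linarith
  have hlim : Tendsto (fun n => x - (y n : ℝ) / q ^ n) atTop (nhds (x - 0)) := by
    refine tendsto_const_nhds.sub ?_
    refine squeeze_zero (fun n => div_nonneg (y n).2.1 (by positivity))
      (fun n => ?_) ((tendsto_pow_atTop_atTop_of_one_lt hq).const_div_atTop (M / (q - 1)))
    have := (y n).2.2
    gcongr
  have h2 := (summable_piQ hq hd).hasSum.tendsto_sum_nat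
  simp_rw [hsum] at h2
  rw [piQ, tendsto_nhds_unique h2 hlim, sub_zero]

lemma piQ_shiftSeq_lt_one_of_lt {M : ℕ} {q : ℝ} (hq : 1 < q) (hqM : q ≤ M + 1) {d : ℕ → ℕ}
    (hd : d ∈ UnivSeqs M q) {n : ℕ} (hn : d n < M) : piQ q (shiftSeq (n + 1) d) < 1 := by
  by_contra! h
  obtain ⟨e, he, hex⟩ := exists_expansion (x := piQ q (shiftSeq (n + 1) d) - 1) hq hqM
    ⟨by linarith, by linarith [piQ_le hq (d := shiftSeq (n + 1) d) fun i => hd.1 _]⟩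
  let f : ℕ → ℕ := fun i => if i < n then d i else if i = n then d n + 1 else e (i - (n + 1))
  have hf : ∀ i, f i ≤ M := by
    intro i
    simp only [f]
    split_ifs
    exacts [hd.1 i, hn, he _]
  have hfd : ∀ i < n, f i = d i := fun i hi => if_pos hi
  have hfn : f n = d n + 1 := by simp [f]
  have hfe : shiftSeq (n + 1) f = e := by
    funext i
    simp only [shiftSeq, f]
    rw [if_neg (by omega), if_neg (by omega)]
    congr 1
    omega
  have hfp : piQ q f = piQ q d := by
    have := piQ_sub_piQ hq hf hd.1 hfd
    rw [hfe, hfn, hex] at this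
    push_cast at this
    rw [← sub_eq_zero, this]
    ring
  have := congrFun (hd.2 f ⟨hf, hfp⟩) n
  omega

lemma reflSeq_mem_univSeqs {M : ℕ} {q : ℝ} (hq : 1 < q) {d : ℕ → ℕ} (hd : d ∈ UnivSeqs M q) :
    reflSeq M d ∈ UnivSeqs M q := by
  refine ⟨reflSeq_le M d, fun e ⟨he, hp⟩ => ?_⟩
  rw [← reflSeq_reflSeq he, hd.2 (reflSeq M e) ⟨reflSeq_le M e, ?_⟩]
  rw [piQ_reflSeq hq he, hp, piQ_reflSeq hq hd.1]
  ring

lemma piQ_shiftSeq_succ_lt_one {M : ℕ} {q : ℝ} (hq : 1 < q) (hqM : q < M + 1) {d : ℕ → ℕ}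
    (hd : d ∈ UnivSeqs M q) {n : ℕ} (hn : piQ q (shiftSeq n d) ≤ 1) :
    piQ q (shiftSeq (n + 1) d) < 1 := by
  rcases (hd.1 n).lt_or_eq with h | h
  · exact piQ_shiftSeq_lt_one_of_lt hq hqM.le hd h
  · have := mul_piQ_shiftSeq hq hd.1 n
    rw [h] at this
    nlinarith

/-- A sequence whose value is below `1` is lexicographically smaller than an expansion of `1`
all of whose proper tails have value below `1`. -/
lemma exists_lt_of_piQ_lt_one {M : ℕ} {q : ℝ} (hq : 1 < q) {α s : ℕ → ℕ}
    (hα : IsExpansion M q 1 α) (ht : ∀ n, piQ q (shiftSeq (n + 1) α) < 1) (hs : ∀ i, s i ≤ M)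
    (h : piQ q s < 1) : ∃ j, (∀ i < j, s i = α i) ∧ s j < α j := by
  have hne : ∃ j, s j ≠ α j := by
    by_contra! h'
    rw [funext h', hα.2] at h
    exact h.false
  classical
  have hlt : ∀ i < Nat.find hne, s i = α i := fun i hi => not_not.1 (Nat.find_min hne hi)
  refine ⟨Nat.find hne, hlt, lt_of_not_ge fun hge => ?_⟩
  have hn := lt_of_le_of_ne hge (Nat.find_spec hne).symm
  have := div_le_piQ_sub_piQ hq hs hα.1 hlt hn le_rfl
  rw [hα.2] at this
  have h0 : 0 < (1 - piQ q (shiftSeq (Nat.find hne + 1) α)) / q ^ (Nat.find hne + 1) :=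
    div_pos (by linarith [ht (Nat.find hne)]) (by positivity)
  linarith

lemma PrefixLe.of_lt {s t : ℕ → ℕ} (h : ∃ j, (∀ i < j, s i = t i) ∧ s j < t j) (N : ℕ) :
    PrefixLe N s t := by
  obtain ⟨j, hj, hlt⟩ := h
  intro k _ hk
  rcases lt_trichotomy j k with h | rfl | h
  · exact absurd (hk j h) hlt.ne
  · exact hlt.le
  · exact (hj k h).le

/-- The lexicographic properties of the unique expansion of `1` in a base `q < M + 1`. -/
structure IsUnivoqueSeq (M : ℕ) (α : ℕ → ℕ) : Prop where
  le : ∀ i, α i ≤ M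
  shift_lt : ∀ n, 0 < n → ∃ j, (∀ i < j, shiftSeq n α i = α i) ∧ shiftSeq n α j < α j
  refl_shift_lt : ∀ n, ∃ j, (∀ i < j, reflSeq M (shiftSeq n α) i = α i) ∧
    reflSeq M (shiftSeq n α) j < α j

lemma piQ_shiftSeq_expansion_lt_one {M : ℕ} {q : ℝ} (hq : 1 < q) (hqM : q < M + 1) {α : ℕ → ℕ}
    (hα : α ∈ UnivSeqs M q) (h1 : piQ q α = 1) (n : ℕ) : piQ q (shiftSeq (n + 1) α) < 1 := by
  induction n with
  | zero =>
    refine piQ_shiftSeq_succ_lt_one hq hqM hα (le_of_eq ?_)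
    rw [shiftSeq_zero, h1]
  | succ n ih => exact piQ_shiftSeq_succ_lt_one hq hqM hα ih.le

lemma isUnivoqueSeq {M : ℕ} (hM : 0 < M) {q : ℝ} (hq : 1 < q) (hqM : q < M + 1) {α : ℕ → ℕ}
    (hα : α ∈ UnivSeqs M q) (h1 : piQ q α = 1) : IsUnivoqueSeq M α := by
  have hx := piQ_shiftSeq_expansion_lt_one hq hqM hα h1
  have hβ := reflSeq_mem_univSeqs hq hα
  have hα0 : reflSeq M α 0 < M := by
    have h := mul_piQ_shiftSeq hq hα.1 0
    have hpos : α 0 ≠ 0 := by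
      intro h0'
      rw [shiftSeq_zero, h1, h0'] at h
      have := hx 0
      push_cast at h
      linarith
    simp only [reflSeq]
    omega
  have hy : ∀ n, piQ q (shiftSeq (n + 1) (reflSeq M α)) < 1 := by
    intro n
    induction n with
    | zero => exact piQ_shiftSeq_lt_one_of_lt hq hqM.le hβ hα0
    | succ n ih => exact piQ_shiftSeq_succ_lt_one hq hqM hβ ih.le
  have hs : ∀ n, 0 < n → ∃ j, (∀ i < j, shiftSeq n α i = α i) ∧ shiftSeq n α j < α j := by
    intro n hn
    obtain ⟨n, rfl⟩ := Nat.exists_eq_succ_of_ne_zero hn.ne'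
    exact exists_lt_of_piQ_lt_one hq ⟨hα.1, h1⟩ hx (fun i => hα.1 _) (hx n)
  have hr : ∀ n, 0 < n → ∃ j, (∀ i < j, reflSeq M (shiftSeq n α) i = α i) ∧
      reflSeq M (shiftSeq n α) j < α j := by
    intro n hn
    obtain ⟨n, rfl⟩ := Nat.exists_eq_succ_of_ne_zero hn.ne'
    exact exists_lt_of_piQ_lt_one hq ⟨hα.1, h1⟩ hx (fun i => reflSeq_le _ _ _) (hy n)
  refine ⟨hα.1, hs, fun n => ?_⟩
  rcases n.eq_zero_or_pos with rfl | hn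
  · rw [shiftSeq_zero]
    obtain ⟨j, hj, hjlt⟩ := hs 1 one_pos
    obtain ⟨k, hk, hklt⟩ := hr 1 one_pos
    simp only [reflSeq] at hk hklt ⊢
    rcases lt_trichotomy j k with h | rfl | h
    · refine ⟨j, fun i hi => ?_, ?_⟩
      · have := hj i hi
        have := hk i (hi.trans h)
        omega
      · have := hk j h
        have := hα.1 j
        omega
    · refine ⟨j, fun i hi => ?_, ?_⟩
      · have := hj i hi
        have := hk i hi
        omega
      · omega
    · refine ⟨k, fun i hi => ?_, ?_⟩
      · have := hj i (hi.trans h)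
        have := hk i hi
        omega
      · have := hj k h
        omega
  · exact hr n hn

/-- No proper nonempty suffix of `α_0 ⋯ α_{n-1}` is a prefix of `α`. -/
def Unbordered (α : ℕ → ℕ) (n : ℕ) : Prop :=
  ∀ k, 0 < k → k < n → ∃ i, k + i < n ∧ α (k + i) ≠ α i

lemma IsUnivoqueSeq.exists_unbordered {M : ℕ} {α : ℕ → ℕ} (h : IsUnivoqueSeq M α) (N : ℕ) :
    ∃ n, N < n ∧ Unbordered α n := by
  induction N with
  | zero => exact ⟨1, one_pos, fun k h0 h1 => by omega⟩
  | succ N ih =>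
    obtain ⟨n, hn, hu⟩ := ih
    obtain ⟨j, hj, hlt⟩ := h.shift_lt n (by omega)
    simp only [shiftSeq] at hj hlt
    refine ⟨n + j + 1, by omega, fun k hk0 hk => ?_⟩
    by_contra! hb
    rcases lt_or_ge k n with hkn | hkn
    · obtain ⟨i, hi, hne⟩ := hu k hk0 hkn
      exact hne (hb i (by omega))
    · obtain ⟨i, rfl⟩ := Nat.exists_eq_add_of_le hkn
      rcases i.eq_zero_or_pos with rfl | hi
      · exact hlt.ne (hb j (by omega))
      · have := PrefixLe.of_lt (h.shift_lt i hi) (j + 1) (j - i) (by omega) (fun l hl => by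
          have h1 := hb l (by omega)
          have h2 := hj (i + l) (by omega)
          rw [← add_assoc] at h2
          simp only [shiftSeq]
          omega)
        have h2 := hb (j - i) (by omega)
        simp only [shiftSeq] at this
        rw [show i + (j - i) = j by omega] at this
        rw [show n + i + (j - i) = n + j by omega] at h2
        omega

/-- The subshift of all sequences whose tails and reflected tails do not exceed `α` on the first
`N` digits. -/
def prefixSubshift (M N : ℕ) (α : ℕ → ℕ) : Set (ℕ → ℕ) :=
  {d | (∀ i, d i ≤ M) ∧
    ∀ n, PrefixLe N (shiftSeq n d) α ∧ PrefixLe N (reflSeq M (shiftSeq n d)) α}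

lemma shiftSeq_mem_prefixSubshift {M N : ℕ} {α d : ℕ → ℕ} (hd : d ∈ prefixSubshift M N α) (n : ℕ) :
    shiftSeq n d ∈ prefixSubshift M N α := by
  refine ⟨fun i => hd.1 _, fun k => ?_⟩
  rw [shiftSeq_shiftSeq]
  exact hd.2 (n + k)

lemma reflSeq_mem_prefixSubshift {M N : ℕ} {α d : ℕ → ℕ} (hd : d ∈ prefixSubshift M N α) :
    reflSeq M d ∈ prefixSubshift M N α := by
  refine ⟨reflSeq_le M d, fun k => ⟨(hd.2 k).2, ?_⟩⟩
  rw [shiftSeq_reflSeq, reflSeq_reflSeq (d := shiftSeq k d) fun i => hd.1 _]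
  exact (hd.2 k).1

lemma sum_range_le_div {M : ℕ} {q r : ℝ} (hq : 1 < q) (hqr : q < r) {α : ℕ → ℕ}
    (hα : IsExpansion M q 1 α) (n : ℕ) :
    ∑ i ∈ Finset.range n, (α i : ℝ) / r ^ (i + 1) ≤ q / r := by
  have hr : 0 < r := by linarith
  have hq0 : 0 < q := by linarith
  calc ∑ i ∈ Finset.range n, (α i : ℝ) / r ^ (i + 1)
      ≤ ∑ i ∈ Finset.range n, q / r * (α i / q ^ (i + 1)) := by
        refine Finset.sum_le_sum fun i _ => ?_
        have h1 : (q / r) ^ i ≤ 1 := pow_le_one₀ (by positivity) ((div_le_one hr).2 hqr.le)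
        have h2 : (α i : ℝ) / r ^ (i + 1) = q / r * (α i / q ^ (i + 1)) * (q / r) ^ i := by
          rw [div_pow, pow_succ, pow_succ]
          field_simp
        rw [h2]
        exact mul_le_of_le_one_right (by positivity) h1
    _ = q / r * ∑ i ∈ Finset.range n, (α i : ℝ) / q ^ (i + 1) := by rw [Finset.mul_sum]
    _ ≤ q / r * 1 := by
        gcongr
        rw [← hα.2]
        exact (summable_piQ hq hα.1).sum_le_tsum _ fun i _ => by positivity
    _ = q / r := mul_one _

/-- In a base larger than `q`, the values of the sequences in the subshift stay away from `1`. -/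
lemma exists_piQ_le_of_mem_prefixSubshift {M N : ℕ} {q r : ℝ} (hq : 1 < q) (hqr : q < r)
    {α : ℕ → ℕ} (hα : IsExpansion M q 1 α) (hN : 0 < N) (hB : q / r + 1 / r ^ N < 1) :
    ∃ T < 1, ∀ s ∈ prefixSubshift M N α, piQ r s ≤ T := by
  have hr : 1 < r := hq.trans hqr
  set X := prefixSubshift M N α
  have hbdd : BddAbove (piQ r '' X) := ⟨M / (r - 1), by
    rintro _ ⟨s, hs, rfl⟩
    exact piQ_le hr hs.1⟩
  rcases X.eq_empty_or_nonempty with hX | hX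
  · exact ⟨0, one_pos, by simp [hX]⟩
  set T := sSup (piQ r '' X)
  have hT : ∀ s ∈ X, piQ r s ≤ T := fun s hs => le_csSup hbdd ⟨s, hs, rfl⟩
  refine ⟨T, lt_of_not_ge fun h1 => ?_, hT⟩
  have hpow : ∀ n, 0 < n → (T - 1) / r ^ n ≤ (T - 1) / r := fun n hn =>
    div_le_div_of_nonneg_left (by linarith) (by linarith) (le_self_pow₀ hr.le hn.ne')
  have key : ∀ s ∈ X, piQ r s ≤ q / r + 1 / r ^ N + (T - 1) / r := by
    intro s hs
    have hle : PrefixLe N s α := by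
      rw [← shiftSeq_zero s]
      exact (hs.2 0).1
    have hN0 : 0 < 1 / r ^ N := by positivity
    by_cases hall : ∀ i < N, s i = α i
    · have h2 := hT _ (shiftSeq_mem_prefixSubshift hs N)
      have h3 := sum_range_le_div hq hqr hα N
      have h4 := hpow N hN
      rw [piQ_eq_sum_add hr hs.1 N,
        Finset.sum_congr rfl fun i hi => by rw [hall i (Finset.mem_range.1 hi)]]
      have h5 : piQ r (shiftSeq N s) / r ^ N ≤ 1 / r ^ N + (T - 1) / r ^ N := by
        rw [← add_div]
        gcongr
        linarith
      linarith
    · push Not at hall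
      classical
      have hmin : ∀ i < Nat.find hall, s i = α i := fun i hi => by
        by_contra hne
        exact Nat.find_min hall hi ⟨hi.trans (Nat.find_spec hall).1, hne⟩
      obtain ⟨hjN, hne⟩ := Nat.find_spec hall
      set j := Nat.find hall
      have hlt : s j < α j := lt_of_le_of_ne (hle j hjN hmin) hne
      have hlt' : (s j : ℝ) + 1 ≤ α j := by exact_mod_cast hlt
      have h2 := hT _ (shiftSeq_mem_prefixSubshift hs (j + 1))
      have h3 := sum_range_le_div hq hqr hα (j + 1)
      have h4 := hpow (j + 1) (by omega)
      rw [piQ_eq_sum_add hr hs.1 (j + 1), Finset.sum_range_succ,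
        Finset.sum_congr rfl fun i hi => by rw [hmin i (Finset.mem_range.1 hi)]]
      rw [Finset.sum_range_succ] at h3
      have h5 : (s j : ℝ) / r ^ (j + 1) + piQ r (shiftSeq (j + 1) s) / r ^ (j + 1)
          ≤ α j / r ^ (j + 1) + (T - 1) / r ^ (j + 1) := by
        rw [← add_div, ← add_div]
        gcongr ?_ / _
        linarith
      linarith
  have hsup : T ≤ q / r + 1 / r ^ N + (T - 1) / r := by
    refine csSup_le (hX.image _) ?_
    rintro _ ⟨s, hs, rfl⟩
    exact key s hs
  have : (T - 1) / r ≤ T - 1 := div_le_self (by linarith) hr.le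
  linarith

lemma prefixSubshift_separated {M N : ℕ} {ρ T : ℝ} (hρ : 1 < ρ) (hT : T < 1) {α : ℕ → ℕ}
    (h : ∀ s ∈ prefixSubshift M N α, piQ ρ s ≤ T) {d e : ℕ → ℕ} (hd : d ∈ prefixSubshift M N α)
    (he : e ∈ prefixSubshift M N α) {k : ℕ} (hk : d k ≠ e k) :
    (1 - T) / ρ ^ (k + 1) ≤ |piQ ρ d - piQ ρ e| := by
  classical
  have hex : ∃ k, d k ≠ e k := ⟨k, hk⟩
  have hmin : ∀ i < Nat.find hex, d i = e i := fun i hi => not_not.1 (Nat.find_min hex hi)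
  have hle : Nat.find hex ≤ k := Nat.find_min' hex hk
  have hne := Nat.find_spec hex
  set n := Nat.find hex
  have h1 : (1 - T) / ρ ^ (k + 1) ≤ (1 - T) / ρ ^ (n + 1) :=
    div_le_div_of_nonneg_left (by linarith) (by positivity)
      (pow_le_pow_right₀ hρ.le (by omega))
  refine h1.trans ?_
  rcases hne.lt_or_gt with hlt | hlt
  · rw [abs_sub_comm]
    exact (div_le_piQ_sub_piQ hρ he.1 hd.1 (fun i hi => (hmin i hi).symm) hlt
      (h _ (shiftSeq_mem_prefixSubshift hd _))).trans (le_abs_self _)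
  · exact (div_le_piQ_sub_piQ hρ hd.1 he.1 hmin hlt
      (h _ (shiftSeq_mem_prefixSubshift he _))).trans (le_abs_self _)

lemma prefixSubshift_subset_univSeqs {M N : ℕ} {r T : ℝ} (hr : 1 < r) (hT : T < 1) {α : ℕ → ℕ}
    (h : ∀ s ∈ prefixSubshift M N α, piQ r s ≤ T) : prefixSubshift M N α ⊆ UnivSeqs M r := by
  intro d hd
  refine ⟨hd.1, fun e ⟨he, hp⟩ => ?_⟩
  by_contra hne
  have hex : ∃ k, e k ≠ d k := by
    by_contra! h'
    exact hne (funext h')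
  classical
  have hmin : ∀ i < Nat.find hex, e i = d i := fun i hi => not_not.1 (Nat.find_min hex hi)
  have hn := Nat.find_spec hex
  set n := Nat.find hex
  have hpos : 0 < (1 - T) / r ^ (n + 1) := div_pos (by linarith) (by positivity)
  rcases hn.lt_or_gt with hlt | hlt
  · have := div_le_piQ_sub_piQ hr (reflSeq_le M e) (reflSeq_le M d) (n := n)
      (fun i hi => by simp only [reflSeq, hmin i hi])
      (by have := hd.1 n; simp only [reflSeq]; omega)
      (h _ (shiftSeq_mem_prefixSubshift (reflSeq_mem_prefixSubshift hd) _))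
    rw [piQ_reflSeq hr he, piQ_reflSeq hr hd.1] at this
    linarith
  · have := div_le_piQ_sub_piQ hr he hd.1 hmin hlt (h _ (shiftSeq_mem_prefixSubshift hd _))
    linarith

/-- The first `m + 1` digits of `α`, the last one being increased by one. -/
def raisedPrefix (α : ℕ → ℕ) (m i : ℕ) : ℕ := if i < m then α i else α i + 1

lemma IsUnivoqueSeq.lt_of_unbordered {M : ℕ} {α : ℕ → ℕ} (h : IsUnivoqueSeq M α) {m : ℕ}
    (hm : 0 < m) (hu : Unbordered α (m + 1)) : α m < M := by
  obtain ⟨i, hi, hne⟩ := hu m hm (by omega)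
  obtain rfl : i = 0 := by omega
  have := PrefixLe.of_lt (h.shift_lt m hm) 1 0 one_pos (by simp)
  simp only [shiftSeq, add_zero] at this hne
  have := h.le 0
  omega

/-- A raised unbordered prefix followed by a reflected prefix of `α` respects the constraints of
the subshift at each of its positions. -/
lemma IsUnivoqueSeq.prefixLe_of_raisedPrefix {M N m : ℕ} {α d : ℕ → ℕ} (h : IsUnivoqueSeq M α)
    (hN : N ≤ m) (hm : 0 < m) (hu : Unbordered α (m + 1)) {P : ℕ}
    (hw : ∀ i ≤ m, d (P + i) = raisedPrefix α m i)
    (ha : ∀ i < N, d (P + (m + 1) + i) = M - α i) {k : ℕ} (hk : k ≤ m) :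
    PrefixLe N (shiftSeq (P + k) d) α ∧ PrefixLe N (reflSeq M (shiftSeq (P + k) d)) α := by
  have hαm := h.lt_of_unbordered hm hu
  have hlow : ∀ i, k + i < m → d (P + k + i) = α (k + i) := fun i hi => by
    rw [add_assoc, hw _ hi.le, raisedPrefix, if_pos hi]
  have hmid : ∀ i, k + i = m → d (P + k + i) = α m + 1 := fun i hi => by
    rw [add_assoc, hi, hw _ le_rfl, raisedPrefix, if_neg (by omega)]
  have hrefl := PrefixLe.of_lt (h.refl_shift_lt k)
  constructor
  · intro j hj hs
    simp only [shiftSeq] at hs ⊢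
    rcases k.eq_zero_or_pos with rfl | hk0
    · rw [hlow j (by omega), zero_add]
    have hsh := PrefixLe.of_lt (h.shift_lt k hk0) (j + 1) j (by omega)
    rcases lt_trichotomy (k + j) m with hkj | hkj | hkj
    · rw [hlow j hkj]
      exact hsh fun i hi => by rw [← hs i hi, hlow i (by omega), shiftSeq]
    · have heq : ∀ i < j, α (k + i) = α i := fun i hi => by rw [← hs i hi, hlow i (by omega)]
      have hle : α (k + j) ≤ α j := hsh heq
      rw [hmid j hkj]
      obtain ⟨i, hi, hne⟩ := hu k hk0 (by omega)
      have : i = j := by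
        by_contra hij
        exact hne (heq i (by omega))
      subst this
      rw [hkj] at hle hne
      omega
    · obtain ⟨l, hl⟩ : ∃ l, m + 1 = k + l := ⟨m + 1 - k, by omega⟩
      obtain ⟨t, rfl⟩ : ∃ t, j = l + t := ⟨j - l, by omega⟩
      have htail : ∀ i < N, d (P + k + (l + i)) = M - α i := fun i hi => by
        rw [← ha i hi]
        congr 1
        omega
      have := PrefixLe.of_lt (h.refl_shift_lt l) (t + 1) t (by omega) (fun i hi => by
        have h1 := hs (l + i) (by omega)
        rw [htail i (by omega)] at h1
        have := h.le i
        simp only [reflSeq, shiftSeq]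
        omega)
      rw [htail t (by omega)]
      simp only [reflSeq, shiftSeq] at this
      omega
  · intro j hj hs
    simp only [reflSeq, shiftSeq] at hs ⊢
    rcases lt_trichotomy (k + j) m with hkj | hkj | hkj
    · rw [hlow j hkj]
      exact hrefl (j + 1) j (by omega) fun i hi => by
        rw [← hs i hi, hlow i (by omega), reflSeq, shiftSeq]
    · have : reflSeq M (shiftSeq k α) j ≤ α j := hrefl (j + 1) j (by omega) fun i hi => by
        rw [← hs i hi, hlow i (by omega), reflSeq, shiftSeq]
      simp only [reflSeq, shiftSeq, hkj] at this
      rw [hmid j hkj]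
      omega
    · have h1 := hs (m - k) (by omega)
      have : reflSeq M (shiftSeq k α) (m - k) ≤ α (m - k) :=
        hrefl (m - k + 1) (m - k) (by omega) fun i hi => by
          rw [← hs i (by omega), hlow i (by omega), reflSeq, shiftSeq]
      rw [hmid (m - k) (by omega)] at h1
      simp only [reflSeq, shiftSeq, show k + (m - k) = m by omega] at this
      omega

/-- The concatenation of blocks of length `m₁ + m₂ + 2`, a block coded by `0` being the raised
prefix for `m₁` followed by the reflected raised prefix for `m₂`, and a block coded by another
digit having the roles of `m₁` and `m₂` exchanged. -/
def blockSeq (M : ℕ) (α : ℕ → ℕ) (m₁ m₂ : ℕ) (c : ℕ → ℕ) (n : ℕ) : ℕ :=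
  if n % (m₁ + m₂ + 2) ≤ (if c (n / (m₁ + m₂ + 2)) = 0 then m₁ else m₂) then
    raisedPrefix α (if c (n / (m₁ + m₂ + 2)) = 0 then m₁ else m₂) (n % (m₁ + m₂ + 2))
  else
    M - raisedPrefix α (if c (n / (m₁ + m₂ + 2)) = 0 then m₂ else m₁)
      (n % (m₁ + m₂ + 2) - ((if c (n / (m₁ + m₂ + 2)) = 0 then m₁ else m₂) + 1))

section blocks

variable {M m₁ m₂ : ℕ} {α c : ℕ → ℕ}

/-- Each block consists of a raised prefix and a reflected raised prefix. -/
lemma exists_blockSeq_eq (M : ℕ) (α : ℕ → ℕ) (m₁ m₂ : ℕ) (c : ℕ → ℕ) (b : ℕ) :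
    ∃ m m', (m = m₁ ∧ m' = m₂ ∨ m = m₂ ∧ m' = m₁) ∧ (c b = 0 → m = m₁) ∧ (c b ≠ 0 → m = m₂) ∧
      (∀ i ≤ m, blockSeq M α m₁ m₂ c ((m₁ + m₂ + 2) * b + i) = raisedPrefix α m i) ∧
      ∀ i ≤ m', blockSeq M α m₁ m₂ c ((m₁ + m₂ + 2) * b + (m + 1) + i) =
        M - raisedPrefix α m' i := by
  have hdiv : ∀ i < m₁ + m₂ + 2, ((m₁ + m₂ + 2) * b + i) / (m₁ + m₂ + 2) = b ∧
      ((m₁ + m₂ + 2) * b + i) % (m₁ + m₂ + 2) = i := fun i hi => by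
    rw [Nat.mul_add_div (by omega), Nat.div_eq_of_lt hi, Nat.mul_add_mod, Nat.mod_eq_of_lt hi]
    exact ⟨rfl, rfl⟩
  by_cases hc : c b = 0
  · refine ⟨m₁, m₂, by simp, by simp, by simp [hc], fun i hi => ?_, fun i hi => ?_⟩
    · obtain ⟨h1, h2⟩ := hdiv i (by omega)
      simp only [blockSeq, h1, h2, hc, if_true, if_pos hi]
    · obtain ⟨h1, h2⟩ := hdiv (m₁ + 1 + i) (by omega)
      rw [add_assoc]
      simp only [blockSeq, h1, h2, hc, if_true]
      rw [if_neg (by omega), Nat.add_sub_cancel_left]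
  · refine ⟨m₂, m₁, by simp, by simp [hc], by simp, fun i hi => ?_, fun i hi => ?_⟩
    · obtain ⟨h1, h2⟩ := hdiv i (by omega)
      simp only [blockSeq, h1, h2, hc, if_false, if_pos hi]
    · obtain ⟨h1, h2⟩ := hdiv (m₂ + 1 + i) (by omega)
      rw [add_assoc]
      simp only [blockSeq, h1, h2, hc, if_false]
      rw [if_neg (by omega), Nat.add_sub_cancel_left]

lemma IsUnivoqueSeq.raisedPrefix_le (h : IsUnivoqueSeq M α) {m : ℕ} (hm : α m < M) {i : ℕ}
    (hi : i ≤ m) : raisedPrefix α m i ≤ M := by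
  unfold raisedPrefix
  split_ifs with him
  · exact h.le i
  · obtain rfl : i = m := by omega
    exact hm

lemma exists_eq_block_add (L n : ℕ) (hL : 0 < L) : ∃ b p, p < L ∧ n = L * b + p :=
  ⟨n / L, n % L, Nat.mod_lt _ hL, (Nat.div_add_mod n L).symm⟩

lemma IsUnivoqueSeq.blockSeq_mem {N : ℕ} (h : IsUnivoqueSeq M α) (hN : 0 < N) (h₁ : N ≤ m₁)
    (h₂ : N ≤ m₂) (hu₁ : Unbordered α (m₁ + 1)) (hu₂ : Unbordered α (m₂ + 1)) (c : ℕ → ℕ) :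
    blockSeq M α m₁ m₂ c ∈ prefixSubshift M N α := by
  have hα₁ := h.lt_of_unbordered (hN.trans_le h₁) hu₁
  have hα₂ := h.lt_of_unbordered (hN.trans_le h₂) hu₂
  have hd : ∀ i, blockSeq M α m₁ m₂ c i ≤ M := by
    intro n
    obtain ⟨b, p, hp, rfl⟩ := exists_eq_block_add (m₁ + m₂ + 2) n (by omega)
    obtain ⟨m, m', hm, -, -, hw, hw'⟩ := exists_blockSeq_eq M α m₁ m₂ c b
    rcases le_or_gt p m with hpm | hpm
    · rw [hw p hpm]
      rcases hm with ⟨rfl, rfl⟩ | ⟨rfl, rfl⟩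
      · exact h.raisedPrefix_le hα₁ hpm
      · exact h.raisedPrefix_le hα₂ hpm
    · obtain ⟨t, rfl⟩ := Nat.exists_eq_add_of_le (Nat.succ_le_of_lt hpm)
      rw [Nat.succ_eq_add_one, ← add_assoc, hw' t (by omega)]
      exact Nat.sub_le _ _
  refine ⟨hd, fun n => ?_⟩
  obtain ⟨b, p, hp, rfl⟩ := exists_eq_block_add (m₁ + m₂ + 2) n (by omega)
  obtain ⟨m, m', hm, -, -, hw, hw'⟩ := exists_blockSeq_eq M α m₁ m₂ c b
  obtain ⟨l, l', hl, -, -, hv, -⟩ := exists_blockSeq_eq M α m₁ m₂ c (b + 1)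
  have hNm : N ≤ m ∧ Unbordered α (m + 1) ∧ α m < M := by
    rcases hm with ⟨rfl, rfl⟩ | ⟨rfl, rfl⟩ <;> exact ⟨‹_›, ‹_›, ‹_›⟩
  have hNm' : N ≤ m' ∧ Unbordered α (m' + 1) ∧ α m' < M := by
    rcases hm with ⟨rfl, rfl⟩ | ⟨rfl, rfl⟩ <;> exact ⟨‹_›, ‹_›, ‹_›⟩
  rcases le_or_gt p m with hpm | hpm
  · refine h.prefixLe_of_raisedPrefix hNm.1 (by omega) hNm.2.1 hw (fun i hi => ?_) hpm
    rw [hw' i (by omega), raisedPrefix, if_pos (by omega)]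
  · obtain ⟨t, rfl⟩ := Nat.exists_eq_add_of_le (Nat.succ_le_of_lt hpm)
    have := h.prefixLe_of_raisedPrefix (d := reflSeq M (blockSeq M α m₁ m₂ c)) hNm'.1 (by omega)
      hNm'.2.1 (P := (m₁ + m₂ + 2) * b + (m + 1)) (fun i hi => ?_) (fun i hi => ?_) (k := t)
      (by omega)
    · rw [shiftSeq_reflSeq, reflSeq_reflSeq (d := shiftSeq _ _) fun i => hd _, add_assoc] at this
      exact this.symm
    · have := h.raisedPrefix_le hNm'.2.2 hi
      rw [reflSeq, hw' i hi]
      omega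
    · have : (m₁ + m₂ + 2) * b + (m + 1) + (m' + 1) + i = (m₁ + m₂ + 2) * (b + 1) + i := by
        rcases hm with ⟨rfl, rfl⟩ | ⟨rfl, rfl⟩ <;> ring
      rw [reflSeq, this, hv i (by omega), raisedPrefix, if_pos (by omega)]

lemma exists_blockSeq_ne (hm : m₁ < m₂) {c c' : ℕ → ℕ} {b : ℕ} (hc : c b = 0) (hc' : c' b ≠ 0) :
    blockSeq M α m₁ m₂ c ((m₁ + m₂ + 2) * b + m₁) ≠
      blockSeq M α m₁ m₂ c' ((m₁ + m₂ + 2) * b + m₁) := by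
  obtain ⟨m, -, -, hm1, -, hw, -⟩ := exists_blockSeq_eq M α m₁ m₂ c b
  obtain ⟨n, -, -, -, hn1, hv, -⟩ := exists_blockSeq_eq M α m₁ m₂ c' b
  obtain rfl := hm1 hc
  obtain rfl := hn1 hc'
  rw [hw _ le_rfl, hv _ hm.le, raisedPrefix, raisedPrefix, if_pos hm, if_neg (by omega)]
  omega

lemma one_le_piQ_of_raisedPrefix {q : ℝ} (hq : 1 < q) {s : ℕ → ℕ} (hα : IsExpansion M q 1 α)
    (ht : ∀ n, piQ q (shiftSeq (n + 1) α) < 1) (hs : ∀ i, s i ≤ M) {m : ℕ}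
    (hw : ∀ i ≤ m, s i = raisedPrefix α m i) : 1 ≤ piQ q s := by
  have := div_le_piQ_sub_piQ hq hs hα.1 (n := m)
    (fun i hi => by rw [hw i hi.le, raisedPrefix, if_pos hi])
    (by rw [hw m le_rfl, raisedPrefix, if_neg (by omega)]; omega) (ht m).le
  rw [hα.2, sub_self, zero_div] at this
  linarith

lemma blockSeq_notMem_univSeqs {q : ℝ} (hq : 1 < q)
    (hqM : q ≤ M + 1) (hα : IsExpansion M q 1 α) (ht : ∀ n, piQ q (shiftSeq (n + 1) α) < 1)
    (hM : 0 < M) (c : ℕ → ℕ) : blockSeq M α m₁ m₂ c ∉ UnivSeqs M q := by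
  intro hmem
  obtain ⟨m, m', hm, -, -, -, hw'⟩ := exists_blockSeq_eq M α m₁ m₂ c 0
  obtain ⟨l, l', hl, -, -, hv, -⟩ := exists_blockSeq_eq M α m₁ m₂ c 1
  have h1 := hw' m' le_rfl
  rw [mul_zero, zero_add, raisedPrefix, if_neg (by omega)] at h1
  have hlt := piQ_shiftSeq_lt_one_of_lt hq hqM hmem (n := m + 1 + m') (by omega)
  have hL : m + 1 + m' + 1 = (m₁ + m₂ + 2) * 1 := by omega
  rw [hL] at hlt
  exact hlt.not_ge (one_le_piQ_of_raisedPrefix hq hα ht (fun i => hmem.1 _) hv)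

end blocks

/-- A map on binary sequences that separates different sequences at an exponential rate has an
image of positive Hausdorff dimension. -/
lemma dimH_image_binary_pos {F : (ℕ → ℕ) → ℝ} {κ θ : ℝ} (hκ : 0 < κ) (hθ : 0 < θ) (hθ1 : θ < 1)
    (hF : ∀ c c' : ℕ → ℕ, (∀ i, c i ≤ 1) → (∀ i, c' i ≤ 1) → ∀ b, c b ≠ c' b →
      κ * θ ^ b ≤ |F c - F c'|) :
    0 < dimH (F '' {c | ∀ i, c i ≤ 1}) := by
  classical
  set X : Set (ℕ → ℕ) := {c | ∀ i, c i ≤ 1}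
  have hinj : InjOn F X := by
    intro c hc c' hc' h
    by_contra hne
    obtain ⟨b, hb⟩ := Function.ne_iff.1 hne
    have := hF c c' hc hc' b hb
    rw [h, sub_self, abs_zero] at this
    have : 0 < κ * θ ^ b := by positivity
    linarith
  set s : ℝ := Real.log 2 / -Real.log θ
  have hlog : 0 < -Real.log θ := neg_pos.2 (Real.log_neg hθ hθ1)
  have hs : 0 < s := div_pos (Real.log_pos one_lt_two) hlog
  have hθs : θ ^ s = 1 / 2 := by
    rw [Real.rpow_def_of_pos hθ, show Real.log θ * s = -Real.log 2 by
        simp only [s]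
        field_simp [(neg_pos.1 hlog).ne],
      Real.exp_neg, Real.exp_log two_pos]
    norm_num
  have hG : ∀ c ∈ X, ∀ c' ∈ X,
      |piQ 2 c - piQ 2 c'| ≤ κ⁻¹ ^ s * |F c - F c'| ^ s := by
    intro c hc c' hc'
    by_cases hex : ∃ b, c b ≠ c' b
    · have hmin : ∀ i < Nat.find hex, c i = c' i := fun i hi => not_not.1 (Nat.find_min hex hi)
      have hb := hF c c' hc hc' _ (Nat.find_spec hex)
      set b := Nat.find hex
      have h1 : (1 / 2 : ℝ) ^ b ≤ κ⁻¹ ^ s * |F c - F c'| ^ s := by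
        rw [← Real.mul_rpow (by positivity) (abs_nonneg _), ← hθs, ← Real.rpow_natCast,
          ← Real.rpow_mul hθ.le, mul_comm, Real.rpow_mul hθ.le, Real.rpow_natCast]
        refine Real.rpow_le_rpow (by positivity) ?_ hs.le
        rw [inv_mul_eq_div, le_div_iff₀ hκ, mul_comm]
        exact hb
      refine le_trans ?_ h1
      have hsum : ∑ i ∈ Finset.range b, (c i : ℝ) / 2 ^ (i + 1) =
          ∑ i ∈ Finset.range b, (c' i : ℝ) / 2 ^ (i + 1) :=
        Finset.sum_congr rfl fun i hi => by rw [hmin i (Finset.mem_range.1 hi)]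
      rw [piQ_eq_sum_add one_lt_two hc b, piQ_eq_sum_add one_lt_two hc' b, hsum,
        add_sub_add_left_eq_sub, ← sub_div, abs_div, abs_of_pos (by positivity : (0 : ℝ) < 2 ^ b),
        one_div, inv_pow, ← one_div]
      have h2 := piQ_nonneg one_lt_two (shiftSeq b c)
      have h3 := piQ_nonneg one_lt_two (shiftSeq b c')
      have h4 := piQ_le (M := 1) one_lt_two (d := shiftSeq b c) fun i => hc _
      have h5 := piQ_le (M := 1) one_lt_two (d := shiftSeq b c') fun i => hc' _
      norm_num at h4 h5
      gcongr
      rw [abs_le]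
      constructor <;> linarith
    · push Not at hex
      rw [funext hex]
      simp only [sub_self, abs_zero]
      positivity
  have hHol : HolderOnWith (κ⁻¹ ^ s).toNNReal s.toNNReal (fun x => piQ 2 (Function.invFunOn F X x))
      (F '' X) := by
    rintro _ ⟨c, hc, rfl⟩ _ ⟨c', hc', rfl⟩
    simp only [hinj.leftInvOn_invFunOn hc, hinj.leftInvOn_invFunOn hc']
    rw [edist_dist, edist_dist, Real.dist_eq, Real.dist_eq, Real.coe_toNNReal _ hs.le,
      ENNReal.ofReal_rpow_of_nonneg (abs_nonneg _) hs.le, ← ENNReal.ofReal,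
      ← ENNReal.ofReal_mul (by positivity)]
    exact ENNReal.ofReal_le_ofReal (hG c hc c' hc')
  have hdim := hHol.dimH_image_le (Real.toNNReal_pos.2 hs)
  have hsub : Icc (0 : ℝ) 1 ⊆ (fun x => piQ 2 (Function.invFunOn F X x)) '' (F '' X) := by
    intro x hx
    obtain ⟨c, hc, hcx⟩ := exists_expansion (M := 1) (q := 2) one_lt_two (by norm_num) (x := x)
      (by norm_num; exact hx)
    refine ⟨F c, ⟨c, hc, rfl⟩, ?_⟩
    simp only [hinj.leftInvOn_invFunOn (show c ∈ X from hc), hcx]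
  have hone : dimH (Icc (0 : ℝ) 1) = 1 := by
    rw [Real.dimH_of_nonempty_interior (by rw [interior_Icc]; exact ⟨1 / 2, by norm_num⟩)]
    simp
  refine pos_iff_ne_zero.2 fun h0 => ?_
  have := (dimH_mono hsub).trans hdim
  rw [hone, h0, ENNReal.zero_div] at this
  simp at this

/-- If `q ∈ U`, then for every `r ∈ (q, M+1]` and every `ρ ∈ [r, M+1]`, the
Hausdorff dimension of `π_ρ(U'_r \ U'_q)` is strictly positive. -/
theorem stmt19 (M : ℕ) (hM : 0 < M) (q : ℝ) (hq : q ∈ Ioc 1 ((M : ℝ) + 1))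
    (hqU : q ∈ UnivBases M) :
    ∀ r ∈ Ioc q ((M : ℝ) + 1), ∀ ρ ∈ Icc r ((M : ℝ) + 1),
      0 < dimH (piQ ρ '' (UnivSeqs M r \ UnivSeqs M q)) := by
  rintro r ⟨hqr, hrM⟩ ρ ⟨hrρ, -⟩
  have hq1 : 1 < q := hq.1
  have hr1 : 1 < r := hq1.trans hqr
  have hρ1 : 1 < ρ := hr1.trans_le hrρ
  have hqM : q < M + 1 := hqr.trans_le hrM
  obtain ⟨-, -, α, hα, hαu⟩ := hqU
  have hαq : α ∈ UnivSeqs M q := ⟨hα.1, fun e he => hαu e (hα.2 ▸ he)⟩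
  have hu := isUnivoqueSeq hM hq1 hqM hαq hα.2
  obtain ⟨N, hN, hB⟩ : ∃ N, 0 < N ∧ q / r + 1 / r ^ N < 1 := by
    have hlim : Tendsto (fun N : ℕ => q / r + 1 / r ^ N) atTop (nhds (q / r + 0)) :=
      tendsto_const_nhds.add ((tendsto_pow_atTop_atTop_of_one_lt hr1).const_div_atTop 1)
    have hlt : q / r + 0 < 1 := by
      rw [add_zero, div_lt_one (by linarith)]
      exact hqr
    exact ((eventually_gt_atTop 0).and (hlim.eventually_lt_const hlt)).exists
  obtain ⟨T, hT, hXr⟩ := exists_piQ_le_of_mem_prefixSubshift hq1 hqr hα hN hB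
  have hXρ : ∀ s ∈ prefixSubshift M N α, piQ ρ s ≤ T := fun s hs =>
    (piQ_anti hr1 hrρ hs.1).trans (hXr s hs)
  obtain ⟨_ | m₁, hm₁, hu₁⟩ := hu.exists_unbordered N
  · omega
  obtain ⟨_ | m₂, hm₂, hu₂⟩ := hu.exists_unbordered (m₁ + 1)
  · omega
  have hmem := hu.blockSeq_mem (m₁ := m₁) (m₂ := m₂) hN (by omega) (by omega) hu₁ hu₂
  set L := m₁ + m₂ + 2
  have hsep : ∀ c c' : ℕ → ℕ, (∀ i, c i ≤ 1) → (∀ i, c' i ≤ 1) → ∀ b, c b ≠ c' b →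
      (1 - T) / ρ ^ L * ((ρ ^ L)⁻¹) ^ b ≤
        |piQ ρ (blockSeq M α m₁ m₂ c) - piQ ρ (blockSeq M α m₁ m₂ c')| := by
    intro c c' hc1 hc1' b hb
    have hne : blockSeq M α m₁ m₂ c (L * b + m₁) ≠ blockSeq M α m₁ m₂ c' (L * b + m₁) := by
      by_cases hc : c b = 0
      · exact exists_blockSeq_ne (by omega) hc (hc ▸ hb.symm)
      · by_cases hc' : c' b = 0
        · exact (exists_blockSeq_ne (by omega) hc' hc).symm
        · have := hc1 b
          have := hc1' b
          omega
    refine le_trans ?_ (prefixSubshift_separated hρ1 hT hXρ (hmem c) (hmem c') hne)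
    rw [inv_pow, ← div_eq_mul_inv, div_div, ← pow_mul, ← pow_add]
    exact div_le_div_of_nonneg_left (by linarith) (by positivity)
      (pow_le_pow_right₀ hρ1.le (by omega))
  refine (dimH_image_binary_pos (div_pos (by linarith) (by positivity)) (by positivity)
    (inv_lt_one_of_one_lt₀ (one_lt_pow₀ hρ1 (by omega))) hsep).trans_le (dimH_mono ?_)
  rintro _ ⟨c, -, rfl⟩
  exact ⟨_, ⟨prefixSubshift_subset_univSeqs hr1 hT hXr (hmem c),
    blockSeq_notMem_univSeqs hq1 hqM.le hα
      (piQ_shiftSeq_expansion_lt_one hq1 hqM hαq hα.2) hM c⟩, rfl⟩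

end
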